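/- arXiv:2009.08081 — 6 statements merged into one kernel-verified Lean document; each statement's English description precedes it below -/
import Mathlib

section
/- Under the assumptions stated in the context, define ν := −1/(ρ_a·n_a + σ_a²) + 2·ρ_q·n_q·σ_a² / ( π·(ρ_q+σ_q²)·(α + β·ρ_q·n_q)·(ρ_a·n_a + σ_a²)² ) and ξ := √(2/(π·(ρ_q+σ_q²))) · 1/( (α + β·ρ_q·n_q)·(ρ_a·n_a + σ_a²) ). Then the block matrix E = [[ (1/σ_a²)·(I_{N_a} + ν·H·Hᴴ) , −ξ·H·Gᴴ ], [ −ξ·G·Hᴴ , (1/α)·(I_{N_q} − (β/(α + β·ρ_q·n_q))·G·Gᴴ) ]] is a two-sided inverse of C_x, i.e. C_x·E = I and E·C_x = I. (Equation (VIII.18).) -/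
open Matrix Real

/-- For `x ∈ [0, 1]` one has `x ≤ arcsin x`. -/
theorem le_arcsin_of_mem_Icc {x : ℝ} (h0 : 0 ≤ x) (h1 : x ≤ 1) : x ≤ Real.arcsin x := by
  have h := Real.sin_le (Real.arcsin_nonneg.2 h0)
  rwa [Real.sin_arcsin (by linarith) h1] at h

/-- If `A * B` is scalar then the inner factors of `(X * A) * (B * Y)` can be pulled out. -/
theorem mul_mul_mul_of_mul_eq_smul_one {R k m l r : Type*} [CommRing R] [Fintype k] [Fintype m]
    [DecidableEq k] {A : Matrix k m R} {B : Matrix m k R} {h : R}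
    (hAB : A * B = h • (1 : Matrix k k R)) (X : Matrix l k R) (Y : Matrix k r R) :
    X * A * (B * Y) = h • (X * Y) := by
  rw [Matrix.mul_assoc, ← Matrix.mul_assoc A, hAB, Matrix.smul_mul, Matrix.one_mul,
    Matrix.mul_smul]

/-- A product of two block matrices built from `H`, `Hs`, `G`, `Gs`, where `Hs * H` and `Gs * G`
are scalar, is the identity as soon as the coefficients satisfy six scalar relations. -/
theorem fromBlocks_mul_fromBlocks_eq_one {R m n k : Type*} [CommRing R]
    [Fintype m] [Fintype n] [Fintype k] [DecidableEq m] [DecidableEq n] [DecidableEq k]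
    {H : Matrix m k R} {Hs : Matrix k m R} {G : Matrix n k R} {Gs : Matrix k n R}
    {h g s t c a b γ ν ξ μ : R}
    (hH : Hs * H = h • (1 : Matrix k k R)) (hG : Gs * G = g • (1 : Matrix k k R))
    (hst : s * t = 1) (hab : a * b = 1)
    (h₁₁ : t + t * ν * h + s * t * ν - c * ξ * g = 0)
    (h₁₂ : -(ξ * h) - s * ξ + c * b - c * b * μ * g = 0)
    (h₂₁ : c * t + c * t * ν * h - a * ξ - γ * ξ * g = 0)
    (h₂₂ : γ * b - γ * b * μ * g - a * b * μ - c * ξ * h = 0) :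
    fromBlocks (H * Hs + s • (1 : Matrix m m R)) (c • (H * Gs))
        (c • (G * Hs)) (a • (1 : Matrix n n R) + γ • (G * Gs)) *
      fromBlocks (t • ((1 : Matrix m m R) + ν • (H * Hs))) (-(ξ • (H * Gs)))
        (-(ξ • (G * Hs))) (b • ((1 : Matrix n n R) - μ • (G * Gs))) = 1 := by
  rw [fromBlocks_multiply, ← fromBlocks_one]
  congr 1
  · simp only [Matrix.add_mul, Matrix.mul_add, Matrix.smul_mul, Matrix.mul_smul, Matrix.mul_neg,
      Matrix.mul_one, Matrix.one_mul,
      mul_mul_mul_of_mul_eq_smul_one hH, mul_mul_mul_of_mul_eq_smul_one hG]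
    linear_combination (norm := module) h₁₁ • (H * Hs) + hst • (1 : Matrix m m R)
  · simp only [Matrix.add_mul, Matrix.mul_sub, Matrix.smul_mul, Matrix.mul_smul, Matrix.mul_neg,
      Matrix.mul_one, Matrix.one_mul,
      mul_mul_mul_of_mul_eq_smul_one hH, mul_mul_mul_of_mul_eq_smul_one hG]
    linear_combination (norm := module) h₁₂ • (H * Gs)
  · simp only [Matrix.add_mul, Matrix.mul_add, Matrix.smul_mul, Matrix.mul_smul, Matrix.mul_neg,
      Matrix.mul_one, Matrix.one_mul,
      mul_mul_mul_of_mul_eq_smul_one hH, mul_mul_mul_of_mul_eq_smul_one hG]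
    linear_combination (norm := module) h₂₁ • (G * Hs)
  · simp only [Matrix.add_mul, Matrix.mul_sub, Matrix.smul_mul, Matrix.mul_smul, Matrix.mul_neg,
      Matrix.mul_one, Matrix.one_mul,
      mul_mul_mul_of_mul_eq_smul_one hH, mul_mul_mul_of_mul_eq_smul_one hG]
    linear_combination (norm := module) h₂₂ • (G * Gs) + hab • (1 : Matrix n n R)

/-- Equation (VIII.18): the explicit block matrix `E` is a two-sided inverse of
the covariance matrix `Cx` of the LGO mixed-resolution model. -/
theorem lgo_covariance_inverse_blocks
    (M na nq : ℕ) (hM : 0 < M) (hna : 0 < na) (hnq : 0 < nq)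
    (ρa ρq σa2 σq2 : ℝ) (hρa : 0 < ρa) (hρq : 0 < ρq)
    (hσa2 : 0 < σa2) (hσq2 : 0 < σq2)
    (H : Matrix (Fin (M * na)) (Fin M) ℂ) (G : Matrix (Fin (M * nq)) (Fin M) ℂ)
    (hH : Hᴴ * H = ((ρa * na : ℝ) : ℂ) • (1 : Matrix (Fin M) (Fin M) ℂ))
    (hG : Gᴴ * G = ((ρq * nq : ℝ) : ℂ) • (1 : Matrix (Fin M) (Fin M) ℂ))
    (α β c : ℝ)
    (hα : α = 1 - (2 / π) * Real.arcsin (ρq / (ρq + σq2)))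
    (hβ : β = (2 / π) * Real.arcsin (ρq / (ρq + σq2)) / ρq
        - 2 * ρa * na / (π * (ρq + σq2) * (ρa * na + σa2)))
    (hc : c = Real.sqrt (2 / (π * (ρq + σq2))))
    (Cx : Matrix (Fin (M * na) ⊕ Fin (M * nq)) (Fin (M * na) ⊕ Fin (M * nq)) ℂ)
    (hCx : Cx = Matrix.fromBlocks
        (H * Hᴴ + (σa2 : ℂ) • 1) ((c : ℂ) • (H * Gᴴ))
        ((c : ℂ) • (G * Hᴴ)) ((α : ℂ) • 1 + (((1 - α) / ρq : ℝ) : ℂ) • (G * Gᴴ)))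
    (ν ξ : ℝ)
    (hν : ν = -(1 / (ρa * na + σa2))
        + 2 * ρq * nq * σa2
          / (π * (ρq + σq2) * (α + β * ρq * nq) * (ρa * na + σa2) ^ 2))
    (hξ : ξ = Real.sqrt (2 / (π * (ρq + σq2)))
          * (1 / ((α + β * ρq * nq) * (ρa * na + σa2))))
    (E : Matrix (Fin (M * na) ⊕ Fin (M * nq)) (Fin (M * na) ⊕ Fin (M * nq)) ℂ)
    (hE : E = Matrix.fromBlocks
        (((1 / σa2 : ℝ) : ℂ) • ((1 : Matrix (Fin (M * na)) (Fin (M * na)) ℂ)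
            + (ν : ℂ) • (H * Hᴴ)))
        (-((ξ : ℂ) • (H * Gᴴ)))
        (-((ξ : ℂ) • (G * Hᴴ)))
        (((1 / α : ℝ) : ℂ) • ((1 : Matrix (Fin (M * nq)) (Fin (M * nq)) ℂ)
            - ((β / (α + β * ρq * nq) : ℝ) : ℂ) • (G * Gᴴ)))) :
    Cx * E = 1 ∧ E * Cx = 1 := by
  have hna' : (0 : ℝ) < na := Nat.cast_pos.2 hna
  have hnq' : (0 : ℝ) < nq := Nat.cast_pos.2 hnq
  have hπ := Real.pi_pos
  have hS : 0 < ρq + σq2 := by positivity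
  have hT : 0 < ρa * na + σa2 := by positivity
  have hx1 : ρq / (ρq + σq2) < 1 := (div_lt_one hS).2 (by linarith)
  have hα0 : 0 < α := by
    have h := mul_lt_mul_of_pos_left (Real.arcsin_lt_pi_div_two.2 hx1) (by positivity : 0 < 2 / π)
    have h' : 2 / π * (π / 2) = 1 := by field_simp
    linarith
  obtain ⟨κ, hκ⟩ : ∃ κ, κ = 2 / (π * (ρq + σq2)) := ⟨_, rfl⟩
  have hκ0 : 0 < κ := by rw [hκ]; positivity
  have hcc : c * c = κ := by rw [hc, ← hκ, Real.mul_self_sqrt hκ0.le]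
  have hβγ : β = (1 - α) / ρq - κ * (ρa * na) / (ρa * na + σa2) := by
    rw [hβ, hα, hκ]; field_simp; ring
  have hβ0 : 0 < β := by
    have h := le_arcsin_of_mem_Icc (by positivity : 0 ≤ ρq / (ρq + σq2)) hx1.le
    have h₁ : κ ≤ (1 - α) / ρq := by
      calc κ = 2 / π * (ρq / (ρq + σq2)) / ρq := by rw [hκ]; field_simp
        _ ≤ 2 / π * Real.arcsin (ρq / (ρq + σq2)) / ρq := by gcongr
        _ = (1 - α) / ρq := by rw [hα]; ring
    have h₂ : κ * (ρa * na) / (ρa * na + σa2) < κ := by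
      rw [div_lt_iff₀ hT]; nlinarith
    linarith
  obtain ⟨D, hD⟩ : ∃ D, D = α + β * ρq * nq := ⟨_, rfl⟩
  have hD0 : 0 < D := by rw [hD]; positivity
  have hν' : ν = -(1 / (ρa * na + σa2)) + κ * (ρq * nq) * σa2 / (D * (ρa * na + σa2) ^ 2) := by
    rw [hν, hκ, ← hD]; field_simp
  have hξ' : ξ = c / (D * (ρa * na + σa2)) := by rw [hξ, ← hc, ← hD]; ring
  rw [← hD] at hE
  obtain ⟨γ, hγ⟩ : ∃ γ, γ = (1 - α) / ρq := ⟨_, rfl⟩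
  rw [← hγ] at hβγ hCx
  have hγβ : γ = β + κ * (ρa * na) / (ρa * na + σa2) := by linarith
  have hαD : α = D - β * (ρq * nq) := by linarith
  have hcξ : c * ξ = κ / (D * (ρa * na + σa2)) := by rw [hξ', ← hcc]; ring
  have hb : 1 / α - 1 / α * (β / D) * (ρq * nq) = 1 / D := by
    field_simp; linarith
  have key : Cx * E = 1 := by
    rw [hCx, hE]
    apply fromBlocks_mul_fromBlocks_eq_one hH hG
    · norm_cast; field_simp
    · norm_cast; field_simp
    · norm_cast
      rw [hcξ, hν']; field_simp; ring
    · norm_cast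
      have h : -(ξ * (ρa * na)) - σa2 * ξ + c * (1 / D) = 0 := by
        rw [hξ']; field_simp; ring
      rw [← hb] at h; linear_combination h
    · norm_cast
      rw [hξ', hν', hγβ, hαD]; field_simp; ring
    · norm_cast
      have h : γ * (1 / D) - β / D - c * ξ * (ρa * na) = 0 := by
        rw [hcξ, hγβ]; field_simp; ring
      have h' : α * (1 / α) = 1 := by field_simp
      rw [← hb] at h; linear_combination h - β / D * h'
  exact ⟨key, mul_eq_one_comm.1 key⟩
end

section
/- Under the assumptions stated in the context, the Schur complement of the analog block in C_x equals α·I_{N_q} + β·G·Gᴴ; explicitly, ( α·I_{N_q} + ((1−α)/ρ_q)·G·Gᴴ ) − (2/(π·(ρ_q+σ_q²)))·(1/σ_a²)·G·Hᴴ·( I_{N_a} − (1/(ρ_a·n_a+σ_a²))·H·Hᴴ )·H·Gᴴ = α·I_{N_q} + β·G·Gᴴ. (Equation (VIII.16).) -/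
open Matrix Real

/-- If the columns of `H` are orthogonal with common squared norm `t`, then compressing
`1 - c • H * Hᴴ` by `H` acts as the scalar `t - c * t ^ 2`. -/
theorem mul_conjTranspose_mul_one_sub_smul_mul {R l m n : Type*} [CommRing R] [StarRing R]
    [Fintype m] [DecidableEq m] [Fintype n] [DecidableEq n]
    (H : Matrix n m R) (G : Matrix l m R) (t c : R) (hH : Hᴴ * H = t • (1 : Matrix m m R)) :
    G * Hᴴ * (1 - c • (H * Hᴴ)) * H * Gᴴ = (t - c * t ^ 2) • (G * Gᴴ) := by
  have compress : Hᴴ * (1 - c • (H * Hᴴ)) * H = (t - c * t ^ 2) • (1 : Matrix m m R) := by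
    calc Hᴴ * (1 - c • (H * Hᴴ)) * H = Hᴴ * H - c • ((Hᴴ * H) * (Hᴴ * H)) := by
          simp only [Matrix.mul_sub, Matrix.sub_mul, Matrix.mul_one, Matrix.mul_smul,
            Matrix.smul_mul, Matrix.mul_assoc]
      _ = (t - c * t ^ 2) • (1 : Matrix m m R) := by
          simp only [hH, Matrix.smul_mul, Matrix.one_mul, smul_smul, sub_smul, sq]
  calc G * Hᴴ * (1 - c • (H * Hᴴ)) * H * Gᴴ = G * (Hᴴ * (1 - c • (H * Hᴴ)) * H) * Gᴴ := by
        simp only [Matrix.mul_assoc]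
    _ = (t - c * t ^ 2) • (G * Gᴴ) := by
        rw [compress, Matrix.mul_smul, Matrix.mul_one, Matrix.smul_mul]

/-- Equation (VIII.16): the Schur complement of the analog block in `Cx`
equals `α·I_{N_q} + β·G·Gᴴ`. -/
theorem lgo_schur_complement
    (M na nq : ℕ) (hM : 0 < M) (hna : 0 < na) (hnq : 0 < nq)
    (ρa ρq σa2 σq2 : ℝ) (hρa : 0 < ρa) (hρq : 0 < ρq)
    (hσa2 : 0 < σa2) (hσq2 : 0 < σq2)
    (H : Matrix (Fin (M * na)) (Fin M) ℂ) (G : Matrix (Fin (M * nq)) (Fin M) ℂ)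
    (hH : Hᴴ * H = ((ρa * na : ℝ) : ℂ) • (1 : Matrix (Fin M) (Fin M) ℂ))
    (hG : Gᴴ * G = ((ρq * nq : ℝ) : ℂ) • (1 : Matrix (Fin M) (Fin M) ℂ))
    (α β : ℝ)
    (hα : α = 1 - (2 / π) * Real.arcsin (ρq / (ρq + σq2)))
    (hβ : β = (2 / π) * Real.arcsin (ρq / (ρq + σq2)) / ρq
        - 2 * ρa * na / (π * (ρq + σq2) * (ρa * na + σa2))) :
    ((α : ℂ) • (1 : Matrix (Fin (M * nq)) (Fin (M * nq)) ℂ)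
        + (((1 - α) / ρq : ℝ) : ℂ) • (G * Gᴴ))
      - ((2 / (π * (ρq + σq2)) : ℝ) : ℂ) • (((1 / σa2 : ℝ) : ℂ)
          • (G * Hᴴ * ((1 : Matrix (Fin (M * na)) (Fin (M * na)) ℂ)
              - ((1 / (ρa * na + σa2) : ℝ) : ℂ) • (H * Hᴴ)) * H * Gᴴ))
      = (α : ℂ) • (1 : Matrix (Fin (M * nq)) (Fin (M * nq)) ℂ) + (β : ℂ) • (G * Gᴴ) := by
  rw [mul_conjTranspose_mul_one_sub_smul_mul H G _ _ hH, smul_smul, smul_smul, add_sub_assoc,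
    ← sub_smul]
  congr 2
  have hden : ρa * na + σa2 ≠ 0 := by positivity
  have hsum : ρq + σq2 ≠ 0 := by positivity
  norm_cast
  rw [hα, hβ]
  field_simp
  ring
end

section
/- Let M and n_q be positive integers, let ρ_q > 0 and σ_q² ≥ 0 be reals, let G₁ ∈ ℂ^{M×M} satisfy G₁·G₁ᴴ = ρ_q·I_M, and let G ∈ ℂ^{(M·n_q)×M} be the vertical stack of n_q copies of G₁ (i.e. G = 1_{n_q} ⊗ G₁, the Kronecker product of the all-ones column vector of length n_q with G₁). Set N_q = M·n_q, C_y := G·Gᴴ + σ_q²·I_{N_q}, and let D := diag(C_y) be the diagonal matrix of the diagonal entries of C_y. Then every entry of D^{−1/2}·C_y·D^{−1/2} is real, and the matrix obtained by applying (2/π)·( arcsin of the real part + i·arcsin of the imaginary part ) entrywise to D^{−1/2}·C_y·D^{−1/2} equals α·I_{N_q} + ((1−α)/ρ_q)·G·Gᴴ, where α := 1 − (2/π)·arcsin(ρ_q/(ρ_q+σ_q²)). (Equation (VIII.10): the arcsine-law covariance of the 1-bit quantized measurements under the LGO model.) -/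
open Matrix Real

/-- The Gram matrix of a vertical stack of copies of `G₁` repeats the Gram matrix of `G₁` in
every block. -/
theorem stack_mul_conjTranspose_apply {ι m n : Type*} [Fintype n]
    {G₁ : Matrix m n ℂ} {G : Matrix (ι × m) n ℂ}
    (hG : ∀ i r c, G (i, r) c = G₁ r c) (p q : ι × m) :
    (G * Gᴴ) p q = (G₁ * G₁ᴴ) p.2 q.2 := by
  obtain ⟨i, r⟩ := p
  obtain ⟨j, s⟩ := q
  simp [Matrix.mul_apply, hG]

/-- Equation (VIII.10): the arcsine-law covariance of the 1-bit quantized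
measurements under the LGO model. With `G` the vertical stack of `n_q` copies
of `G₁` (`G₁·G₁ᴴ = ρ_q·I_M`), `C_y = G·Gᴴ + σ_q²·I`, and `D = diag(C_y)`, the
matrix `D^{−1/2}·C_y·D^{−1/2}` has real entries and applying
`(2/π)·(arcsin(Re·) + i·arcsin(Im·))` entrywise to it yields
`α·I + ((1−α)/ρ_q)·G·Gᴴ`. -/
theorem lgo_arcsine_law_quantized_covariance
    (M nq : ℕ) (hM : 0 < M) (hnq : 0 < nq)
    (ρq σq2 : ℝ) (hρq : 0 < ρq) (hσq2 : 0 ≤ σq2)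
    (G₁ : Matrix (Fin M) (Fin M) ℂ)
    (hG₁ : G₁ * G₁ᴴ = (ρq : ℂ) • (1 : Matrix (Fin M) (Fin M) ℂ))
    (G : Matrix (Fin nq × Fin M) (Fin M) ℂ)
    (hGstack : ∀ (i : Fin nq) (r : Fin M) (c : Fin M), G (i, r) c = G₁ r c)
    (Cy : Matrix (Fin nq × Fin M) (Fin nq × Fin M) ℂ)
    (hCy : Cy = G * Gᴴ + (σq2 : ℂ) • (1 : Matrix (Fin nq × Fin M) (Fin nq × Fin M) ℂ))
    (Dinvhalf : Matrix (Fin nq × Fin M) (Fin nq × Fin M) ℂ)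
    (hD : Dinvhalf = Matrix.diagonal (fun i => ((1 / Real.sqrt ((Cy i i).re) : ℝ) : ℂ)))
    (B : Matrix (Fin nq × Fin M) (Fin nq × Fin M) ℂ)
    (hB : B = Dinvhalf * Cy * Dinvhalf)
    (α : ℝ)
    (hα : α = 1 - (2 / π) * Real.arcsin (ρq / (ρq + σq2))) :
    (∀ i j, (B i j).im = 0) ∧
    (Matrix.of (fun i j => ((2 / π : ℝ) : ℂ)
        * ((Real.arcsin (B i j).re : ℂ) + (Real.arcsin (B i j).im : ℂ) * Complex.I))
      = (α : ℂ) • (1 : Matrix (Fin nq × Fin M) (Fin nq × Fin M) ℂ)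
          + (((1 - α) / ρq : ℝ) : ℂ) • (G * Gᴴ)) := by
  have hgram : ∀ p q, (G * Gᴴ) p q = ((if p.2 = q.2 then ρq else 0 : ℝ) : ℂ) := by
    intro p q
    rw [stack_mul_conjTranspose_apply hGstack, hG₁]
    by_cases h : p.2 = q.2 <;> simp [h]
  have hCy_apply : ∀ p q, Cy p q =
      (((if p.2 = q.2 then ρq else 0) + (if p = q then σq2 else 0) : ℝ) : ℂ) := by
    intro p q
    rw [hCy, Matrix.add_apply, hgram]
    by_cases h : p = q <;> simp [h]
  have hpos : 0 < ρq + σq2 := by positivity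
  have hB_apply : ∀ p q, B p q =
      ((((if p.2 = q.2 then ρq else 0) + (if p = q then σq2 else 0)) / (ρq + σq2) : ℝ) : ℂ) := by
    intro p q
    rw [hB, hD, Matrix.mul_diagonal, Matrix.diagonal_mul, hCy_apply p p, hCy_apply q q,
      hCy_apply p q]
    simp only [if_true, Complex.ofReal_re]
    rw [← Complex.ofReal_mul, ← Complex.ofReal_mul, Complex.ofReal_inj]
    have hsqrt : √(ρq + σq2) ≠ 0 := (Real.sqrt_pos.mpr hpos).ne'
    nth_rewrite 3 [← Real.mul_self_sqrt hpos.le]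
    field_simp
  refine ⟨fun p q => by rw [hB_apply, Complex.ofReal_im], ?_⟩
  ext p q
  rw [Matrix.of_apply, Matrix.add_apply, Matrix.smul_apply, Matrix.smul_apply, hgram, hB_apply,
    Complex.ofReal_re, Complex.ofReal_im, Real.arcsin_zero]
  by_cases hpq : p = q
  · subst hpq
    have hρ : (ρq : ℂ) ≠ 0 := by exact_mod_cast hρq.ne'
    have hπ : (π : ℂ) ≠ 0 := by exact_mod_cast Real.pi_ne_zero
    simp only [if_true, div_self hpos.ne', Real.arcsin_one, Matrix.one_apply_eq]
    push_cast
    simp only [smul_eq_mul]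
    field_simp
    ring
  · by_cases hrow : p.2 = q.2
    · have hρ : (ρq : ℂ) ≠ 0 := by exact_mod_cast hρq.ne'
      simp only [hpq, hrow, if_true, if_false, add_zero, Matrix.one_apply_ne hpq, hα]
      push_cast
      simp only [smul_eq_mul]
      field_simp
      ring
    · simp [hpq, hrow]
end

section
/- For every nonnegative integer n_q, MSE(n_a, n_q + 1) ≤ MSE(n_a, n_q); that is, for any fixed number of analog measurement blocks, adding a quantized measurement block never increases the MSE of the LMMSE estimator under the LGO model. (Inequality (IX.1).) -/
open Real

/-- The arcsine dominates the identity on `[0, 1]`. -/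
theorem le_arcsin_self {x : ℝ} (h0 : 0 ≤ x) (h1 : x ≤ 1) : x ≤ arcsin x := by
  have hpi := Real.pi_gt_three
  rw [Real.le_arcsin_iff_sin_le ⟨by linarith, by linarith⟩ ⟨by linarith, h1⟩]
  exact Real.sin_le h0

/-- Inequality (IX.1): for any fixed number of analog measurement blocks,
adding a quantized measurement block never increases the MSE of the LMMSE
estimator under the LGO model. -/
theorem mse_monotone_in_quantized
    (M : ℕ) (hM : 0 < M) (na : ℕ)
    (ρa ρq σa2 σq2 : ℝ) (hρa : 0 < ρa) (hρq : 0 < ρq)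
    (hσa2 : 0 < σa2) (hσq2 : 0 < σq2)
    (α : ℝ) (hα : α = 1 - (2 / π) * Real.arcsin (ρq / (ρq + σq2)))
    (β : ℕ → ℝ)
    (hβ : ∀ na' : ℕ, β na' = (2 / π) * Real.arcsin (ρq / (ρq + σq2)) / ρq
        - 2 * ρa * na' / (π * (ρq + σq2) * (ρa * na' + σa2)))
    (MSE : ℕ → ℕ → ℝ)
    (hMSE : ∀ na' nq' : ℕ, MSE na' nq' = M - M * (ρa * na' / (ρa * na' + σa2)
        + 2 * ρq * nq' * σa2 ^ 2
          / (π * (ρq + σq2) * (α + β na' * ρq * nq') * (ρa * na' + σa2) ^ 2))) :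
    ∀ nq : ℕ, MSE na (nq + 1) ≤ MSE na nq := by
  intro nq
  have hpi := Real.pi_pos
  have hs : 0 < ρq + σq2 := by positivity
  have hd : 0 < ρa * na + σa2 := by positivity
  have hx0 : 0 ≤ ρq / (ρq + σq2) := by positivity
  have hx1 : ρq / (ρq + σq2) < 1 := by rw [div_lt_one hs]; linarith
  have hα0 : 0 < α := by
    have h := Real.arcsin_lt_pi_div_two.2 hx1
    have h' := mul_lt_mul_of_pos_left h (show 0 < 2 / π by positivity)
    have e : 2 / π * (π / 2) = 1 := by field_simp
    rw [hα]
    linarith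
  have hβ0 : 0 ≤ β na := by
    have ht : ρa * na / (ρa * na + σa2) ≤ 1 := by rw [div_le_one hd]; linarith
    have hxt : ρq / (ρq + σq2) * (ρa * na / (ρa * na + σa2)) ≤ arcsin (ρq / (ρq + σq2)) :=
      (mul_le_of_le_one_right hx0 ht).trans (le_arcsin_self hx0 hx1.le)
    have e : β na = 2 / (π * ρq) * (arcsin (ρq / (ρq + σq2))
        - ρq / (ρq + σq2) * (ρa * na / (ρa * na + σa2))) := by
      rw [hβ, mul_sub]
      congr 1 <;> field_simp
    rw [e]
    exact mul_nonneg (by positivity) (sub_nonneg.2 hxt)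
  rw [hMSE, hMSE]
  gcongr _ - _ * (_ + ?_)
  rw [div_le_div_iff₀ (by positivity) (by positivity)]
  have h : 0 ≤ 2 * ρq * σa2 ^ 2 * (π * (ρq + σq2)) * (ρa * na + σa2) ^ 2 * α := by positivity
  push_cast
  linear_combination h
end

section
/- Let b be a positive integer and P̃ a nonnegative integer (the normalized power budget). For any pair of nonnegative integers (n_a, n_q) satisfying the power constraint 2^b·M·n_a + 2·M·n_q ≤ P̃, define n_q* := ⌊(P̃ − 2^b·M·n_a)/(2·M)⌋. Then the pair (n_a, n_q*) also satisfies 2^b·M·n_a + 2·M·n_q* ≤ P̃, and MSE(n_a, n_q*) ≤ MSE(n_a, n_q). Consequently, the power-constrained MSE minimization over (n_a, n_q) is solved by a one-dimensional search over n_a ∈ {0, 1, …, ⌊P̃/(2^b·M)⌋} with n_q chosen as n_q* for each n_a. (Proposition 1.) -/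
open Real

theorem Real.le_arcsin_of_nonneg {x : ℝ} (hx0 : 0 ≤ x) (hx1 : x ≤ 1) : x ≤ arcsin x := by
  simpa [Real.sin_arcsin (by linarith) hx1] using Real.sin_le (Real.arcsin_nonneg.mpr hx0)

/-- A map `x ↦ x / (a + b x)` with `a > 0`, `b ≥ 0` is nondecreasing on `[0, ∞)`. -/
theorem div_add_mul_le_div_add_mul {a b x y : ℝ} (ha : 0 < a) (hb : 0 ≤ b) (hx : 0 ≤ x)
    (hxy : x ≤ y) : x / (a + b * x) ≤ y / (a + b * y) := by
  have hy : 0 ≤ y := hx.trans hxy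
  rw [div_le_div_iff₀ (by positivity) (by positivity)]
  nlinarith [mul_le_mul_of_nonneg_left hxy ha.le]

/-- Proposition 1: for any feasible pair `(n_a, n_q)` under the power
constraint `2^b·M·n_a + 2·M·n_q ≤ P̃`, replacing `n_q` by
`n_q* = ⌊(P̃ − 2^b·M·n_a)/(2·M)⌋` remains feasible and does not increase the
MSE; hence the power-constrained minimization reduces to a one-dimensional
search over `n_a`. -/
theorem resource_allocation_one_dimensional_search
    (M : ℕ) (hM : 0 < M)
    (ρa ρq σa2 σq2 : ℝ) (hρa : 0 < ρa) (hρq : 0 < ρq)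
    (hσa2 : 0 < σa2) (hσq2 : 0 < σq2)
    (α : ℝ) (hα : α = 1 - (2 / π) * Real.arcsin (ρq / (ρq + σq2)))
    (β : ℕ → ℝ)
    (hβ : ∀ na' : ℕ, β na' = (2 / π) * Real.arcsin (ρq / (ρq + σq2)) / ρq
        - 2 * ρa * na' / (π * (ρq + σq2) * (ρa * na' + σa2)))
    (MSE : ℕ → ℕ → ℝ)
    (hMSE : ∀ na' nq' : ℕ, MSE na' nq' = M - M * (ρa * na' / (ρa * na' + σa2)
        + 2 * ρq * nq' * σa2 ^ 2
          / (π * (ρq + σq2) * (α + β na' * ρq * nq') * (ρa * na' + σa2) ^ 2)))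
    (b : ℕ) (hb : 0 < b) (P : ℕ)
    (na nq : ℕ) (hpow : 2 ^ b * M * na + 2 * M * nq ≤ P) :
    2 ^ b * M * na + 2 * M * ((P - 2 ^ b * M * na) / (2 * M)) ≤ P ∧
    MSE na ((P - 2 ^ b * M * na) / (2 * M)) ≤ MSE na nq := by
  have hle : nq ≤ (P - 2 ^ b * M * na) / (2 * M) := by
    rw [Nat.le_div_iff_mul_le (by omega), mul_comm nq]
    omega
  refine ⟨?_, ?_⟩
  · have := Nat.mul_div_le (P - 2 ^ b * M * na) (2 * M)
    omega
  generalize (P - 2 ^ b * M * na) / (2 * M) = nq' at hle ⊢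
  have hπ := Real.pi_pos
  have hx0 : 0 ≤ ρq / (ρq + σq2) := by positivity
  have hx1 : ρq / (ρq + σq2) < 1 := by
    rw [div_lt_one (by positivity)]
    linarith
  have hαpos : 0 < α := by
    have h := mul_lt_mul_of_pos_left (Real.arcsin_lt_pi_div_two.mpr hx1)
      (show 0 < 2 / π by positivity)
    have h1 : 2 / π * (π / 2) = 1 := by field_simp
    linarith
  have hβnonneg : 0 ≤ β na := by
    have harcsin : 2 / π * (ρq / (ρq + σq2)) / ρq ≤
        2 / π * Real.arcsin (ρq / (ρq + σq2)) / ρq := by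
      gcongr
      exact Real.le_arcsin_of_nonneg hx0 hx1.le
    have hfrac : ρa * na / (ρa * na + σa2) ≤ 1 := by
      rw [div_le_one (by positivity)]
      linarith
    have hscaled := mul_le_mul_of_nonneg_left hfrac
      (show 0 ≤ 2 / π * (ρq / (ρq + σq2)) / ρq by positivity)
    have heq : 2 * ρa * na / (π * (ρq + σq2) * (ρa * na + σa2)) =
        2 / π * (ρq / (ρq + σq2)) / ρq * (ρa * na / (ρa * na + σa2)) := by
      have : ρa * na + σa2 ≠ 0 := by positivity
      field_simp
    rw [hβ, heq]
    linarith
  have hmono := div_add_mul_le_div_add_mul hαpos (mul_nonneg hβnonneg hρq.le)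
    (Nat.cast_nonneg nq) (Nat.cast_le (α := ℝ).mpr hle)
  have hfactor (n : ℕ) : 2 * ρq * n * σa2 ^ 2
      / (π * (ρq + σq2) * (α + β na * ρq * n) * (ρa * na + σa2) ^ 2) =
      2 * ρq * σa2 ^ 2 / (π * (ρq + σq2) * (ρa * na + σa2) ^ 2) *
        (n / (α + β na * ρq * n)) := by
    rw [div_mul_div_comm]
    congr 1 <;> ring
  rw [hMSE, hMSE, hfactor, hfactor]
  gcongr
end

section
/- Let ρ > 0 and σ² > 0 be reals, M a positive integer, and n ≥ 1 an integer. Then the pure-analog MSE with n analog blocks exceeds the noiseless-quantization mixed MSE with n−1 analog blocks, i.e. M·σ²/(ρ·n+σ²) < M − M·( ρ·(n−1)/(ρ·(n−1)+σ²) + 2·σ⁴ / ( π·(ρ·(n−1)+σ²)² − 2·ρ·(n−1)·(ρ·(n−1)+σ²) ) ), if and only if ( (π−2)·ρ² − 2·ρ·σ² )·n > 2·σ⁴ − π·ρ·σ² + (π−2)·ρ². (The equivalence underlying condition (III.C.5): comparison of Option 2 with n_a = n analog blocks against Option 1 with n_a = n−1 analog blocks plus noiseless quantized measurements.) -/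
open Real

/-- The equivalence underlying condition (III.C.5): the pure-analog MSE with
`n` analog blocks exceeds the noiseless-quantization mixed MSE with `n − 1`
analog blocks iff `((π−2)·ρ² − 2·ρ·σ²)·n > 2·σ⁴ − π·ρ·σ² + (π−2)·ρ²`. -/
theorem option_comparison_condition
    (ρ σ2 : ℝ) (hρ : 0 < ρ) (hσ2 : 0 < σ2)
    (M : ℕ) (hM : 0 < M) (n : ℕ) (hn : 1 ≤ n) :
    (M * σ2 / (ρ * n + σ2)
      < M - M * (ρ * ((n : ℝ) - 1) / (ρ * ((n : ℝ) - 1) + σ2)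
          + 2 * σ2 ^ 2
            / (π * (ρ * ((n : ℝ) - 1) + σ2) ^ 2
              - 2 * ρ * ((n : ℝ) - 1) * (ρ * ((n : ℝ) - 1) + σ2))))
    ↔ ((π - 2) * ρ ^ 2 - 2 * ρ * σ2) * n
        > 2 * σ2 ^ 2 - π * ρ * σ2 + (π - 2) * ρ ^ 2 := by
  have hMr : (0 : ℝ) < M := by exact_mod_cast hM
  have hnr : (1 : ℝ) ≤ n := by exact_mod_cast hn
  obtain ⟨a, ha⟩ : ∃ a, a = ρ * ((n : ℝ) - 1) := ⟨_, rfl⟩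
  have ha0 : 0 ≤ a := ha ▸ mul_nonneg hρ.le (sub_nonneg.2 hnr)
  have hn_eq : ρ * n = a + ρ := by rw [ha]; ring
  have hE : 0 < π * (a + σ2) - 2 * a := by
    nlinarith [mul_nonneg (sub_nonneg.2 pi_gt_three.le) ha0, mul_pos pi_pos hσ2]
  have hD : π * (a + σ2) ^ 2 - 2 * ρ * ((n : ℝ) - 1) * (a + σ2)
      = (a + σ2) * (π * (a + σ2) - 2 * a) := by rw [ha]; ring
  have hb : 0 < a + σ2 := by positivity
  have hc : 0 < a + ρ + σ2 := by positivity
  rw [← ha, hD, hn_eq]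
  have key : M - M * (a / (a + σ2) + 2 * σ2 ^ 2 / ((a + σ2) * (π * (a + σ2) - 2 * a)))
        - M * σ2 / (a + ρ + σ2)
      = M * σ2 / ((a + σ2) * (a + ρ + σ2) * (π * (a + σ2) - 2 * a))
        * (ρ * (π * (a + σ2) - 2 * a) - 2 * σ2 * (a + ρ + σ2)) := by
    have hE_ne := hE.ne'
    generalize π * (a + σ2) - 2 * a = E at hE_ne ⊢
    field_simp
    ring
  have hcond : ((π - 2) * ρ ^ 2 - 2 * ρ * σ2) * n
        - (2 * σ2 ^ 2 - π * ρ * σ2 + (π - 2) * ρ ^ 2)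
      = ρ * (π * (a + σ2) - 2 * a) - 2 * σ2 * (a + ρ + σ2) := by rw [ha]; ring
  rw [gt_iff_lt, ← sub_pos, key, mul_pos_iff_of_pos_left (by positivity), ← hcond, sub_pos]
end
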